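/- Let (a,b,c,d) ∈ P_gen, γ ∈ ℂ*, and let x ∈ ℝ_q with |x| < 1/|b| (so that the series defining φ_γ and φ_γ† converge at x and qx). Then D(φ_γ, φ_γ†)(x) = [(1−q)q/(as)] · (sγ, s/γ;q)_∞ · θ(a/b) / (cq/a, cq/b, dq/a, dq/b;q)_∞. -/

import Mathlib

open Complex Filter

noncomputable section

namespace VVBQJ

/-- The infinite q-shifted factorial `(x;q)_∞`. -/
def poch (q x : ℂ) : ℂ := ∏' j : ℕ, (1 - x * q ^ j)

/-- The q-shifted factorial `(x;q)_n`, `n ∈ ℕ`. -/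
def pochN (q x : ℂ) (n : ℕ) : ℂ := ∏ j ∈ Finset.range n, (1 - x * q ^ j)

/-- The normalized Jacobi theta function `θ(x) = (x;q)_∞ (q/x;q)_∞`. -/
def theta (q x : ℂ) : ℂ := poch q x * poch q (q / x)

/-- The condition on the pairs `(a,b)` and `(c,d)` in the parameter set `P`. -/
def pairCond (q zm zp : ℝ) (α β : ℂ) : Prop :=
  α = (starRingEnd ℂ) β ∨
    (∃ (A B : ℝ) (k₀ : ℤ), α = (A : ℂ) ∧ β = (B : ℂ) ∧
      zp * q ^ k₀ < 1 / B ∧ 1 / B < 1 / A ∧ 1 / A < zp * q ^ (k₀ - 1)) ∨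
    (∃ (A B : ℝ) (k₀ : ℤ), α = (A : ℂ) ∧ β = (B : ℂ) ∧
      zm * q ^ (k₀ - 1) < 1 / A ∧ 1 / A < 1 / B ∧ 1 / B < zm * q ^ k₀)

/-- The parameter domain `P`. -/
def memP (q zm zp : ℝ) (a b c d : ℂ) : Prop :=
  a ≠ 0 ∧ b ≠ 0 ∧ c ≠ 0 ∧ d ≠ 0 ∧ a ≠ b ∧
    (∀ x ∈ ({a, b, c, d} : Set ℂ), ∀ k : ℤ,
      x ≠ ((zp : ℂ))⁻¹ * (q : ℂ) ^ k ∧ x ≠ ((zm : ℂ))⁻¹ * (q : ℂ) ^ k) ∧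
    pairCond q zm zp a b ∧ pairCond q zm zp c d

/-- The generic parameter domain `P_gen`. -/
def memPgen (q zm zp : ℝ) (a b c d : ℂ) : Prop :=
  memP q zm zp a b c d ∧ c ≠ d ∧
    ∀ k : ℤ, c / a ≠ (q : ℂ) ^ k ∧ c / b ≠ (q : ℂ) ^ k ∧ d / a ≠ (q : ℂ) ^ k ∧
      d / b ≠ (q : ℂ) ^ k ∧ c * d / (a * b) ≠ (q : ℂ) ^ k

/-- `s = √(cdq/(ab))`, with the principal branch of the square root. -/
def sP (q : ℝ) (a b c d : ℂ) : ℂ := (c * d * (q : ℂ) / (a * b)) ^ ((1 : ℂ) / 2)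

def Acoef (q : ℝ) (a b c d : ℂ) (x : ℝ) : ℂ :=
  (sP q a b c d)⁻¹ * (1 - (q : ℂ) / (a * (x : ℂ))) * (1 - (q : ℂ) / (b * (x : ℂ)))

def Bcoef (q : ℝ) (a b c d : ℂ) (x : ℝ) : ℂ :=
  sP q a b c d * (1 - 1 / (c * (x : ℂ))) * (1 - 1 / (d * (x : ℂ)))

def Ccoef (q : ℝ) (a b c d : ℂ) (x : ℝ) : ℂ :=
  sP q a b c d + (sP q a b c d)⁻¹ - Acoef q a b c d x - Bcoef q a b c d x

/-- The second order q-difference operator `L`. -/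
def Lop (q : ℝ) (a b c d : ℂ) (f : ℝ → ℂ) (x : ℝ) : ℂ :=
  Acoef q a b c d x * f (x / q) + Bcoef q a b c d x * f (q * x) + Ccoef q a b c d x * f x

/-- The weight function `w`. -/
def w (q : ℝ) (a b c d : ℂ) (x : ℝ) : ℂ :=
  poch q (a * (x : ℂ)) * poch q (b * (x : ℂ)) / (poch q (c * (x : ℂ)) * poch q (d * (x : ℂ)))

/-- The function `u(x) = (1-q)² B(x) x² w(x)`. -/
def u (q : ℝ) (a b c d : ℂ) (x : ℝ) : ℂ :=
  (1 - (q : ℂ)) ^ 2 * Bcoef q a b c d x * (x : ℂ) ^ 2 * w q a b c d x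

/-- The Casorati determinant `D(f,g)`. -/
def casD (q : ℝ) (a b c d : ℂ) (f g : ℝ → ℂ) (x : ℝ) : ℂ :=
  (f x * g (q * x) - f (q * x) * g x) * u q a b c d x / ((1 - (q : ℂ)) * (x : ℂ))

/-- The truncated inner product `⟨f,g⟩_{k,l;m,n}`. -/
def trunc (q zm zp : ℝ) (a b c d : ℂ) (f g : ℝ → ℂ) (k l m n : ℤ) : ℂ :=
  (1 - (q : ℂ)) *
    ((∑ j ∈ Finset.Icc n m, f (zp * q ^ j) * (starRingEnd ℂ) (g (zp * q ^ j)) *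
        w q a b c d (zp * q ^ j) * ((zp * q ^ j : ℝ) : ℂ)) -
      ∑ j ∈ Finset.Icc k l, f (zm * q ^ j) * (starRingEnd ℂ) (g (zm * q ^ j)) *
        w q a b c d (zm * q ^ j) * ((zm * q ^ j : ℝ) : ℂ))

/-- The constant `K_z`. -/
def Kz (q : ℝ) (a b c d : ℂ) (z : ℝ) : ℂ :=
  (z : ℂ) * (1 - (q : ℂ)) * (theta q (a * z) * theta q (b * z)) /
    (theta q (c * z) * theta q (d * z))

/-- Membership in the Hilbert space `ℒ²(ℝ_q, w(x) d_q x)`. -/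
def memL2 (q zm zp : ℝ) (a b c d : ℂ) (f : ℝ → ℂ) : Prop :=
  Summable (fun k : ℤ => ‖f (zp * q ^ k)‖ ^ 2 * ‖w q a b c d (zp * q ^ k)‖ * |zp * q ^ k|) ∧
    Summable (fun k : ℤ => ‖f (zm * q ^ k)‖ ^ 2 * ‖w q a b c d (zm * q ^ k)‖ * |zm * q ^ k|)

/-- The inner product on `ℒ²`. -/
def innerL2 (q zm zp : ℝ) (a b c d : ℂ) (f g : ℝ → ℂ) : ℂ :=
  (1 - (q : ℂ)) *
    ((∑' k : ℤ, f (zp * q ^ k) * (starRingEnd ℂ) (g (zp * q ^ k)) *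
        w q a b c d (zp * q ^ k) * ((zp * q ^ k : ℝ) : ℂ)) -
      ∑' k : ℤ, f (zm * q ^ k) * (starRingEnd ℂ) (g (zm * q ^ k)) *
        w q a b c d (zm * q ^ k) * ((zm * q ^ k : ℝ) : ℂ))

/-- The squared `ℒ²`-norm. -/
def normSqL2 (q zm zp : ℝ) (a b c d : ℂ) (f : ℝ → ℂ) : ℝ :=
  (1 - q) *
    ((∑' k : ℤ, ‖f (zp * q ^ k)‖ ^ 2 * ‖w q a b c d (zp * q ^ k)‖ * (zp * q ^ k)) +
      ∑' k : ℤ, ‖f (zm * q ^ k)‖ ^ 2 * ‖w q a b c d (zm * q ^ k)‖ * (-(zm * q ^ k)))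

/-- The q-difference operator `D_q`. -/
def Dq (q : ℝ) (f : ℝ → ℂ) (x : ℝ) : ℂ := (f x - f (q * x)) / ((1 - (q : ℂ)) * (x : ℂ))

/-- The q-line `ℝ_q`. -/
def Rq (q zm zp : ℝ) : Set ℝ := {x | ∃ k : ℤ, x = zm * q ^ k ∨ x = zp * q ^ k}

/-- Membership in the domain `𝒟`. -/
def memD (q zm zp : ℝ) (a b c d : ℂ) (f : ℝ → ℂ) : Prop :=
  memL2 q zm zp a b c d f ∧ memL2 q zm zp a b c d (Lop q a b c d f) ∧
    (∃ v : ℂ, Tendsto (fun k : ℕ => f (zm * q ^ k)) atTop (nhds v) ∧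
        Tendsto (fun k : ℕ => f (zp * q ^ k)) atTop (nhds v)) ∧
    (∃ v : ℂ, Tendsto (fun k : ℕ => Dq q f (zm * q ^ k)) atTop (nhds v) ∧
        Tendsto (fun k : ℕ => Dq q f (zp * q ^ k)) atTop (nhds v))

/-- Membership in the eigenspace `V_μ` (functions on `ℝ_q`). -/
def memV (q zm zp : ℝ) (a b c d : ℂ) (μ : ℂ) (f : ℝ → ℂ) : Prop :=
  (∀ x ∈ Rq q zm zp, Lop q a b c d f x = μ * f x) ∧
    (∃ v : ℂ, Tendsto (fun k : ℕ => f (zm * q ^ k)) atTop (nhds v) ∧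
        Tendsto (fun k : ℕ => f (zp * q ^ k)) atTop (nhds v)) ∧
    (∃ v : ℂ, Tendsto (fun k : ℕ => Dq q f (zm * q ^ k)) atTop (nhds v) ∧
        Tendsto (fun k : ℕ => Dq q f (zp * q ^ k)) atTop (nhds v))

/-- The set of regular spectral values `S_reg = ℂ* \ {± q^{k/2}}`. -/
def Sreg (q : ℝ) (γ : ℂ) : Prop :=
  γ ≠ 0 ∧ ∀ k : ℤ, γ ≠ ((q ^ ((k : ℝ) / 2) : ℝ) : ℂ) ∧ γ ≠ -((q ^ ((k : ℝ) / 2) : ℝ) : ℂ)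

/-- The big q-Jacobi function `φ_γ(x)`. -/
def phi (q : ℝ) (a b c d : ℂ) (γ x : ℂ) : ℂ :=
  ∑' n : ℕ,
    pochN q (q / (a * x)) n * pochN q (sP q a b c d * γ) n * pochN q (sP q a b c d / γ) n /
      (pochN q q n * pochN q (c * q / a) n * pochN q (d * q / a) n) * (b * x) ^ n

/-- The asymptotic solution `Φ_γ(z q^{-k})`, in index form. -/
def PhiIdx (q : ℝ) (a b c d : ℂ) (γ : ℂ) (z : ℝ) (k : ℤ) : ℂ :=
  let s : ℂ := sP q a b c d
  let x : ℂ := (z : ℂ) * (q : ℂ) ^ (-k)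
  (s * γ) ^ k *
    (poch q ((q : ℂ) / (b * x)) * poch q ((q : ℂ) ^ 2 * γ / (a * s * x)) /
      (poch q ((q : ℂ) / (c * x)) * poch q ((q : ℂ) / (d * x)))) *
    ∑' n : ℕ,
      pochN q ((q : ℂ) * γ / s) n * pochN q (c * q * γ / (s * a)) n *
          pochN q (d * q * γ / (s * a)) n /
        (pochN q q n * pochN q ((q : ℂ) ^ 2 * γ / (a * s * x)) n * pochN q ((q : ℂ) * γ ^ 2) n) *
        ((q : ℂ) / (b * x)) ^ n

/-- Casorati determinant at `x = z q^{-k}` for index-form functions. -/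
def casDIdx (q : ℝ) (a b c d : ℂ) (f g : ℤ → ℂ) (z : ℝ) (k : ℤ) : ℂ :=
  (f k * g (k - 1) - f (k - 1) * g k) * u q a b c d (z * q ^ (-k)) /
    ((1 - (q : ℂ)) * ((z * q ^ (-k) : ℝ) : ℂ))

/-- The c-function `c_z(γ)`. -/
def cz (q : ℝ) (a b c d : ℂ) (z : ℝ) (γ : ℂ) : ℂ :=
  let s : ℂ := sP q a b c d
  poch q (s / γ) * poch q (c * q / (a * s * γ)) * poch q (d * q / (a * s * γ)) *
      theta q (b * s * z * γ) /
    (poch q (c * q / a) * poch q (d * q / a) * poch q (1 / γ ^ 2) * theta q (b * z))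

/-- The expansion coefficient `d_z(γ)`. -/
def dz (q : ℝ) (a b c d : ℂ) (z : ℝ) (γ : ℂ) : ℂ :=
  let s : ℂ := sP q a b c d
  (poch q (c * q / a) * poch q (d * q / a) * theta q (b * z) /
      (theta q (a / b) * theta q (c * z) * theta q (d * z))) *
    (poch q (c * q * γ / (s * b)) * poch q (d * q * γ / (s * b)) *
        theta q (a * s * z / (q * γ)) /
      (poch q (q * γ ^ 2) * poch q (s / γ)))

/-- The Casorati determinant `v(γ) = D(Φ_γ^+, Φ_γ^-)`. -/
def vFun (q zm zp : ℝ) (a b c d : ℂ) (γ : ℂ) : ℂ :=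
  let s : ℂ := sP q a b c d;
  -((zp : ℂ) * (1 - (q : ℂ)) * theta q ((zm : ℂ) / zp) /
      (theta q (c * zm) * theta q (d * zm) * theta q (c * zp) * theta q (d * zp))) *
    (poch q (c * q * γ / (a * s)) * poch q (d * q * γ / (a * s)) * poch q (c * q * γ / (b * s)) *
        poch q (d * q * γ / (b * s)) * poch q (s * γ) * poch q (q * γ / s) *
        theta q (a * b * s * zm * zp / (q * γ)) /
      (γ * (poch q (q * γ ^ 2)) ^ 2))

/-- The function `v₁(γ)` in the continuous part of the spectral measure. -/
def v1Fun (q zm zp : ℝ) (a b c d : ℂ) (γ : ℂ) : ℂ :=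
  let s : ℂ := sP q a b c d
  ((poch q (c * q / a)) ^ 2 * (poch q (d * q / a)) ^ 2 * theta q (b * zp) * theta q (b * zm) /
      ((1 - (q : ℂ)) * a * b * (zm : ℂ) ^ 2 * (zp : ℂ) ^ 2 *
        (theta q ((zm : ℂ) / zp) * theta q ((zp : ℂ) / zm) * theta q (a / b) * theta q (b / a)))) *
    (poch q (γ ^ 2) * poch q (γ⁻¹ ^ 2) /
      (poch q (s * γ) * poch q (s / γ) * poch q (c * q * γ / (a * s)) *
        poch q (c * q / (a * s * γ)) * poch q (d * q * γ / (a * s)) *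
        poch q (d * q / (a * s * γ)) *
        (theta q (s * γ) * theta q (s / γ) * theta q (a * b * s * zm * zp * γ) *
          theta q (a * b * s * zm * zp / γ)))) *
    ((zm : ℂ) * (theta q (a * zp) * theta q (c * zp) * theta q (d * zp) * theta q (b * zm) *
          theta q (a * s * zm * γ) * theta q (a * s * zm / γ)) -
      (zp : ℂ) * (theta q (a * zm) * theta q (c * zm) * theta q (d * zm) * theta q (b * zp) *
          theta q (a * s * zp * γ) * theta q (a * s * zp / γ)))

/-- The function `v₂(γ)` in the continuous part of the spectral measure. -/
def v2Fun (q zm zp : ℝ) (a b c d : ℂ) (γ : ℂ) : ℂ :=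
  let s : ℂ := sP q a b c d
  (poch q (c * q / a) * poch q (d * q / a) * poch q (c * q / b) * poch q (d * q / b) *
      (theta q (a * zp) * theta q (a * zm) * theta q (b * zp) * theta q (b * zm) *
        theta q (c * d * zm * zp)) /
      (a * b * (zm : ℂ) ^ 2 * (zp : ℂ) * (1 - (q : ℂ)) *
        (theta q ((zp : ℂ) / zm) * theta q (a / b) * theta q (b / a)))) *
    (poch q (γ ^ 2) * poch q (γ⁻¹ ^ 2) /
      (poch q (s * γ) * poch q (s / γ) *
        (theta q (s * γ) * theta q (s / γ) * theta q (a * b * s * zm * zp * γ) *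
          theta q (a * b * s * zm * zp / γ))))

/-- The function `u₁(γ)`. -/
def u1Fun (q zm zp : ℝ) (a b c d : ℂ) (γ : ℂ) : ℂ :=
  Kz q a b c d zp * cz q a b c d zp γ * cz q a b c d zp γ⁻¹ -
    Kz q a b c d zm * cz q a b c d zm γ * cz q a b c d zm γ⁻¹

/-- The function `u₂(γ)`. -/
def u2Fun (q zm zp : ℝ) (a b c d : ℂ) (γ : ℂ) : ℂ :=
  Kz q a b c d zp * cz q a b c d zp γ * cz q b a c d zp γ⁻¹ -
    Kz q a b c d zm * cz q a b c d zm γ * cz q b a c d zm γ⁻¹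

/-- The big q-Jacobi polynomial `P_k(y; α, β, δ; q)`. -/
def bigqJacobiP (q : ℝ) (α β δ : ℂ) (k : ℕ) (y : ℂ) : ℂ :=
  ∑ j ∈ Finset.range (k + 1),
    pochN q (((q : ℂ) ^ k)⁻¹) j * pochN q (α * β * (q : ℂ) ^ (k + 1)) j * pochN q y j /
      (pochN q q j * pochN q (α * q) j * pochN q (δ * q) j) * (q : ℂ) ^ j

lemma pochN_succ (q x : ℂ) (n : ℕ) : pochN q x (n + 1) = pochN q x n * (1 - x * q ^ n) :=
  Finset.prod_range_succ _ _

lemma summable_norm_mul_pow {q : ℂ} (hq : ‖q‖ < 1) (x : ℂ) :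
    Summable fun j : ℕ => ‖-(x * q ^ j)‖ := by
  simpa [norm_mul, norm_pow] using (summable_geometric_of_lt_one (norm_nonneg q) hq).mul_left ‖x‖

lemma multipliable_poch {q : ℂ} (hq : ‖q‖ < 1) (x : ℂ) :
    Multipliable fun j : ℕ => (1 - x * q ^ j) := by
  simpa [sub_eq_add_neg] using multipliable_one_add_of_summable (summable_norm_mul_pow hq x)

lemma tendsto_pochN {q : ℂ} (hq : ‖q‖ < 1) (x : ℂ) :
    Tendsto (pochN q x) atTop (nhds (poch q x)) :=
  (multipliable_poch hq x).hasProd.tendsto_prod_nat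

lemma poch_ne_zero {q x : ℂ} (hq : ‖q‖ < 1) (hx : ∀ n : ℕ, 1 - x * q ^ n ≠ 0) :
    poch q x ≠ 0 := by
  have := tprod_one_add_ne_zero_of_summable (f := fun j : ℕ => -(x * q ^ j))
    (fun j => by simpa [sub_eq_add_neg] using hx j) (summable_norm_mul_pow hq x)
  simpa [poch, sub_eq_add_neg] using this

lemma pochN_ne_zero {q x : ℂ} (hx : ∀ n : ℕ, 1 - x * q ^ n ≠ 0) (n : ℕ) : pochN q x n ≠ 0 :=
  Finset.prod_ne_zero_iff.mpr fun j _ => hx j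

lemma poch_eq_mul {q : ℂ} (hq : ‖q‖ < 1) (x : ℂ) :
    poch q x = (1 - x) * poch q (x * q) := by
  have h := (multipliable_poch hq (x * q)).congr (g := fun j : ℕ => 1 - x * q ^ (j + 1))
    (fun j => by ring)
  have := tprod_eq_zero_mul' (f := fun j : ℕ => 1 - x * q ^ j) h
  rw [poch, this, poch]
  simp only [pow_zero, mul_one]
  congr 1
  exact tprod_congr fun j => by ring

lemma continuous_poch {q : ℂ} (hq : ‖q‖ < 1) : Continuous (poch q) := by
  refine continuous_iff_continuousAt.mpr fun x => ?_
  have hsum : Summable fun j : ℕ => (‖x‖ + 1) * ‖q‖ ^ j :=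
    (summable_geometric_of_lt_one (norm_nonneg q) hq).mul_left _
  have := tendsto_tprod_one_add_of_dominated_convergence (𝓕 := nhds x)
    (f := fun (y : ℂ) (j : ℕ) => -(y * q ^ j)) (g := fun j => -(x * q ^ j)) hsum
    (fun j => ((continuous_id.mul continuous_const).neg.tendsto x)) (by
      filter_upwards [Metric.ball_mem_nhds x one_pos] with y hy j
      rw [norm_neg, norm_mul, norm_pow]
      gcongr
      have := norm_sub_norm_le y x
      rw [Metric.mem_ball, dist_eq_norm] at hy
      linarith)
  simpa [ContinuousAt, poch, sub_eq_add_neg] using! this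

/-- The Newton-type polynomials `∏_{j<n} (y - q^{j+1})`. -/
def newtonPoly (q y : ℂ) (n : ℕ) : ℂ := ∏ j ∈ Finset.range n, (y - q ^ (j + 1))

/-- The series with coefficients `k` in the Newton-type polynomials. -/
def newtonSum (q : ℂ) (k : ℕ → ℂ) (y : ℂ) : ℂ := ∑' n, k n * newtonPoly q y n

lemma newtonPoly_succ (q y : ℂ) (n : ℕ) :
    newtonPoly q y (n + 1) = newtonPoly q y n * (y - q ^ (n + 1)) :=
  Finset.prod_range_succ _ _

lemma newtonPoly_zero (q y : ℂ) : newtonPoly q y 0 = 1 := rfl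

lemma continuous_newtonPoly (q : ℂ) (n : ℕ) : Continuous fun y => newtonPoly q y n :=
  continuous_finsetProd _ fun _ _ => continuous_id.sub continuous_const

lemma newtonPoly_succ_mul_left (q y : ℂ) (n : ℕ) :
    newtonPoly q (q * y) (n + 1) = q ^ (n + 1) * (y - 1) * newtonPoly q y n := by
  induction n with
  | zero => simp [newtonPoly]; ring
  | succ n ih => rw [newtonPoly_succ, ih, newtonPoly_succ]; ring

lemma newtonPoly_sub (q y : ℂ) (n : ℕ) :
    newtonPoly q y (n + 1) - newtonPoly q (q * y) (n + 1) =
      y * (1 - q ^ (n + 1)) * newtonPoly q y n := by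
  rw [newtonPoly_succ_mul_left, newtonPoly_succ]; ring

lemma newtonPoly_self (q : ℂ) (n : ℕ) : newtonPoly q q (n + 1) = 0 :=
  Finset.prod_eq_zero (Finset.mem_range.mpr n.succ_pos) (by simp)

lemma newtonPoly_mul_pow (q β y : ℂ) (h : β * y = 1) (n : ℕ) :
    β ^ n * newtonPoly q y n = pochN q (β * q) n := by
  induction n with
  | zero => simp [newtonPoly, pochN]
  | succ n ih =>
    rw [newtonPoly_succ, pochN_succ, ← ih]
    linear_combination β ^ n * newtonPoly q y n * h

lemma exists_norm_newtonPoly_le {q : ℂ} (hq : ‖q‖ < 1) {ρ : ℝ} (hρ : 0 < ρ) :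
    ∃ K, ∀ y, ‖y‖ ≤ ρ → ∀ n, ‖newtonPoly q y n‖ ≤ K * ρ ^ n := by
  have hs : Summable fun j : ℕ => ‖q‖ ^ (j + 1) / ρ := by
    simpa [pow_succ] using
      ((summable_geometric_of_lt_one (norm_nonneg q) hq).mul_right ‖q‖).div_const ρ
  refine ⟨Real.exp (∑' j : ℕ, ‖q‖ ^ (j + 1) / ρ), fun y hy n => ?_⟩
  calc ‖newtonPoly q y n‖ = ∏ j ∈ Finset.range n, ‖y - q ^ (j + 1)‖ := norm_prod _ _
    _ ≤ ∏ j ∈ Finset.range n, (Real.exp (‖q‖ ^ (j + 1) / ρ) * ρ) := by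
      refine Finset.prod_le_prod (fun _ _ => norm_nonneg _) fun j _ => ?_
      calc ‖y - q ^ (j + 1)‖ ≤ ‖y‖ + ‖q‖ ^ (j + 1) := by
            simpa [norm_pow] using norm_sub_le y (q ^ (j + 1))
        _ ≤ ρ + ‖q‖ ^ (j + 1) := by gcongr
        _ = (‖q‖ ^ (j + 1) / ρ + 1) * ρ := by field_simp; ring
        _ ≤ _ := by gcongr; exact Real.add_one_le_exp _
    _ = Real.exp (∑ j ∈ Finset.range n, ‖q‖ ^ (j + 1) / ρ) * ρ ^ n := by
      rw [Finset.prod_mul_distrib, Real.exp_sum]; simp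
    _ ≤ _ := by
      gcongr
      exact hs.sum_le_tsum _ fun j _ => by positivity

lemma summable_newton {q : ℂ} (hq : ‖q‖ < 1) {k : ℕ → ℂ} {ρ : ℝ} (hρ : 0 < ρ)
    (hk : Summable fun n => ‖k n‖ * ρ ^ n) {y : ℂ} (hy : ‖y‖ ≤ ρ) :
    Summable fun n => k n * newtonPoly q y n := by
  obtain ⟨K, hK⟩ := exists_norm_newtonPoly_le hq hρ
  refine (hk.mul_left K).of_norm_bounded fun n => ?_
  rw [norm_mul]
  calc ‖k n‖ * ‖newtonPoly q y n‖ ≤ ‖k n‖ * (K * ρ ^ n) := by gcongr; exact hK y hy n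
    _ = _ := by ring

lemma continuousOn_newtonSum {q : ℂ} (hq : ‖q‖ < 1) {k : ℕ → ℂ} {ρ : ℝ} (hρ : 0 < ρ)
    (hk : Summable fun n => ‖k n‖ * ρ ^ n) :
    ContinuousOn (newtonSum q k) (Metric.closedBall 0 ρ) := by
  obtain ⟨K, hK⟩ := exists_norm_newtonPoly_le hq hρ
  refine continuousOn_tsum (fun n => (continuous_const.mul (continuous_newtonPoly q n)).continuousOn)
    (hk.mul_left K) fun n y hy => ?_
  rw [norm_mul]
  calc ‖k n‖ * ‖newtonPoly q y n‖ ≤ ‖k n‖ * (K * ρ ^ n) := by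
        gcongr; exact hK y (by simpa using hy) n
    _ = _ := by ring

lemma exists_radius {β y : ℂ} (hβ : β ≠ 0) (hy : ‖β * y‖ < 1) :
    ∃ ρ : ℝ, 0 < ρ ∧ ‖y‖ < ρ ∧ ‖β‖ * ρ < 1 := by
  have hb : 0 < ‖β‖ := norm_pos_iff.mpr hβ
  rw [norm_mul] at hy
  have : ‖y‖ < 1 / ‖β‖ := by rw [lt_div_iff₀ hb]; linarith
  obtain ⟨ρ, h1, h2⟩ := exists_between this
  refine ⟨ρ, (norm_nonneg y).trans_lt h1, h1, ?_⟩
  rw [lt_div_iff₀ hb] at h2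
  linarith

lemma summable_norm_mul_of_growth {k : ℕ → ℂ} {M σ ρ : ℝ} (hσ : 0 ≤ σ) (hρ : 0 < ρ)
    (hk : ∀ n, ‖k n‖ ≤ M * σ ^ n) (h : σ * ρ < 1) : Summable fun n => ‖k n‖ * ρ ^ n := by
  refine ((summable_geometric_of_lt_one (by positivity) h).mul_left M).of_nonneg_of_le
    (fun n => by positivity) fun n => ?_
  calc ‖k n‖ * ρ ^ n ≤ M * σ ^ n * ρ ^ n := by gcongr; exact hk n
    _ = _ := by rw [mul_pow]; ring

lemma summable_newton_of_growth {q : ℂ} (hq : ‖q‖ < 1) {k : ℕ → ℂ} {M : ℝ} {β y : ℂ}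
    (hβ : β ≠ 0) (hk : ∀ n, ‖k n‖ ≤ M * ‖β‖ ^ n) (hy : ‖β * y‖ < 1) :
    Summable fun n => k n * newtonPoly q y n := by
  obtain ⟨ρ, h0, h1, h2⟩ := exists_radius hβ hy
  exact summable_newton hq h0 (summable_norm_mul_of_growth (norm_nonneg β) h0 hk h2) h1.le

lemma continuousAt_newtonSum {q : ℂ} (hq : ‖q‖ < 1) {k : ℕ → ℂ} {M : ℝ} {β y : ℂ}
    (hβ : β ≠ 0) (hk : ∀ n, ‖k n‖ ≤ M * ‖β‖ ^ n) (hy : ‖β * y‖ < 1) :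
    ContinuousAt (newtonSum q k) y := by
  obtain ⟨ρ, h0, h1, h2⟩ := exists_radius hβ hy
  refine (continuousOn_newtonSum hq h0
    (summable_norm_mul_of_growth (norm_nonneg β) h0 hk h2)).continuousAt ?_
  exact Filter.mem_of_superset (Metric.isOpen_ball.mem_nhds (by simpa using h1))
    Metric.ball_subset_closedBall

/-- The coefficients `(A,B;q)_n / (q,C,D;q)_n`. -/
def hypCoef (q A B C D : ℂ) (n : ℕ) : ℂ :=
  pochN q A n * pochN q B n / (pochN q q n * pochN q C n * pochN q D n)

/-- The series `Σ (A,B;q)_n / (q,C,D;q)_n β^n ∏_{j<n} (y - q^{j+1})`. -/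
def hypSum (q A B C D β : ℂ) : ℂ → ℂ := newtonSum q fun n => hypCoef q A B C D n * β ^ n

/-- The series of the q-derivative of `hypSum`. -/
def hypDeriv (q A B C D β : ℂ) : ℂ → ℂ :=
  newtonSum q fun n => hypCoef q A B C D (n + 1) * β ^ (n + 1) * (1 - q ^ (n + 1))

lemma hypCoef_zero (q A B C D : ℂ) : hypCoef q A B C D 0 = 1 := by simp [hypCoef, pochN]

lemma one_sub_self_mul_pow_ne_zero {q : ℂ} (hq : ‖q‖ < 1) (n : ℕ) : 1 - q * q ^ n ≠ 0 := by
  intro h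
  have h1 : ‖q ^ (n + 1)‖ = 1 := by
    rw [pow_succ', ← sub_eq_zero.mp h, norm_one]
  rw [norm_pow] at h1
  exact (pow_lt_one₀ (norm_nonneg q) hq n.succ_ne_zero).ne h1

section Hyp

variable {q A B C D β : ℂ}

lemma hypCoef_succ (hq : ‖q‖ < 1) (hC : ∀ n : ℕ, 1 - C * q ^ n ≠ 0)
    (hD : ∀ n : ℕ, 1 - D * q ^ n ≠ 0) (n : ℕ) :
    hypCoef q A B C D (n + 1) * ((1 - q * q ^ n) * (1 - C * q ^ n) * (1 - D * q ^ n)) =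
      hypCoef q A B C D n * ((1 - A * q ^ n) * (1 - B * q ^ n)) := by
  have h1 := pochN_ne_zero (one_sub_self_mul_pow_ne_zero hq) n
  have h2 := pochN_ne_zero hC n
  have h3 := pochN_ne_zero hD n
  have h4 := one_sub_self_mul_pow_ne_zero hq n
  have h5 := hC n
  have h6 := hD n
  simp only [hypCoef, pochN_succ]
  rw [div_mul_eq_mul_div, div_mul_eq_mul_div, div_eq_div_iff (by simp [*]) (by simp [*])]
  ring

lemma tendsto_hypCoef (hq : ‖q‖ < 1) (hC : ∀ n : ℕ, 1 - C * q ^ n ≠ 0)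
    (hD : ∀ n : ℕ, 1 - D * q ^ n ≠ 0) :
    Tendsto (hypCoef q A B C D) atTop
      (nhds (poch q A * poch q B / (poch q q * poch q C * poch q D))) := by
  refine ((tendsto_pochN hq A).mul (tendsto_pochN hq B)).div
    (((tendsto_pochN hq q).mul (tendsto_pochN hq C)).mul (tendsto_pochN hq D)) ?_
  exact mul_ne_zero (mul_ne_zero (poch_ne_zero hq (one_sub_self_mul_pow_ne_zero hq))
    (poch_ne_zero hq hC)) (poch_ne_zero hq hD)

lemma exists_norm_le_of_tendsto {v : ℕ → ℂ} {l : ℂ} (h : Tendsto v atTop (nhds l)) :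
    ∃ M, 0 ≤ M ∧ ∀ n, ‖v n‖ ≤ M := by
  obtain ⟨M, hM⟩ := (Metric.isBounded_range_of_tendsto _ h).exists_norm_le
  exact ⟨M, (norm_nonneg _).trans (hM _ ⟨0, rfl⟩), fun n => hM _ ⟨n, rfl⟩⟩

lemma exists_growth_hypSum (hq : ‖q‖ < 1) (hC : ∀ n : ℕ, 1 - C * q ^ n ≠ 0)
    (hD : ∀ n : ℕ, 1 - D * q ^ n ≠ 0) (β : ℂ) :
    ∃ M, ∀ n, ‖hypCoef q A B C D n * β ^ n‖ ≤ M * ‖β‖ ^ n := by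
  obtain ⟨M, -, hM⟩ := exists_norm_le_of_tendsto (tendsto_hypCoef (A := A) (B := B) hq hC hD)
  refine ⟨M, fun n => ?_⟩
  rw [norm_mul, norm_pow]
  gcongr
  exact hM n

lemma exists_growth_hypDeriv (hq : ‖q‖ < 1) (hC : ∀ n : ℕ, 1 - C * q ^ n ≠ 0)
    (hD : ∀ n : ℕ, 1 - D * q ^ n ≠ 0) (β : ℂ) :
    ∃ M, ∀ n, ‖hypCoef q A B C D (n + 1) * β ^ (n + 1) * (1 - q ^ (n + 1))‖ ≤
      M * ‖β‖ ^ n := by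
  have hqn := tendsto_pow_atTop_nhds_zero_of_norm_lt_one hq
  have h := ((((tendsto_hypCoef (A := A) (B := B) hq hC hD).mul_const β).comp
    (tendsto_add_atTop_nat 1)).mul ((hqn.comp (tendsto_add_atTop_nat 1)).const_sub 1))
  obtain ⟨M, -, hM⟩ := exists_norm_le_of_tendsto h
  refine ⟨M, fun n => ?_⟩
  calc _ = ‖hypCoef q A B C D (n + 1) * β * (1 - q ^ (n + 1))‖ * ‖β‖ ^ n := by
        rw [← norm_pow, ← norm_mul]; ring_nf
    _ ≤ _ := by gcongr; exact hM n

lemma hypSum_sub (hq : ‖q‖ < 1) (hC : ∀ n : ℕ, 1 - C * q ^ n ≠ 0)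
    (hD : ∀ n : ℕ, 1 - D * q ^ n ≠ 0) (hβ : β ≠ 0) {y : ℂ} (hy : ‖β * y‖ < 1)
    (hqy : ‖β * (q * y)‖ < 1) :
    hypSum q A B C D β y - hypSum q A B C D β (q * y) = y * hypDeriv q A B C D β y := by
  obtain ⟨M, hM⟩ := exists_growth_hypSum (A := A) (B := B) hq hC hD β
  have s1 := summable_newton_of_growth hq hβ hM hy
  have s2 := summable_newton_of_growth hq hβ hM hqy
  rw [hypSum, hypDeriv, newtonSum, newtonSum, newtonSum, ← s1.tsum_sub s2,
    (s1.sub s2).tsum_eq_zero_add, ← tsum_mul_left]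
  simp only [newtonPoly_zero, sub_self, zero_add]
  refine tsum_congr fun n => ?_
  rw [← mul_sub, newtonPoly_sub]
  ring

/-- The second order q-difference equation in terms of `hypSum` and `hypDeriv`. -/
lemma hyp_difference_eq (hq : ‖q‖ < 1) (hC : ∀ n : ℕ, 1 - C * q ^ n ≠ 0)
    (hD : ∀ n : ℕ, 1 - D * q ^ n ≠ 0) (hβ : β ≠ 0) (hbal : C * D = A * B * q * β)
    {y : ℂ} (hy : ‖β * y‖ < 1) (hqy : ‖β * (q * y)‖ < 1) :
    (1 - y) * (1 - β * y) * hypDeriv q A B C D β y -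
        (1 - C * y) * (1 - D * y) * hypDeriv q A B C D β (q * y) =
      (A + B - A * B - 1) * (β * y) * hypSum q A B C D β (q * y) := by
  obtain ⟨M, hM⟩ := exists_growth_hypSum (A := A) (B := B) hq hC hD β
  obtain ⟨M', hM'⟩ := exists_growth_hypDeriv (A := A) (B := B) hq hC hD β
  have s1 := summable_newton_of_growth hq hβ hM hqy
  have s2 := summable_newton_of_growth hq hβ hM' hqy
  have s3 := summable_newton_of_growth hq hβ hM' hy
  have hs := (((s3.hasSum.mul_left ((1 - y) * (1 - β * y))).sub
    (s2.hasSum.mul_left ((1 - C * y) * (1 - D * y)))).sub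
    (s1.hasSum.mul_left ((A + B - A * B - 1) * (β * y))))
  rw [← sub_eq_zero]
  refine tendsto_nhds_unique ((tendsto_add_atTop_iff_nat 1).mpr hs.tendsto_sum_nat) ?_
  have hqn := tendsto_pow_atTop_nhds_zero_of_norm_lt_one hq
  have hlim : Tendsto (fun n : ℕ => β * y * (y - 1) * (1 - A * B * q ^ (n + 1)) *
      (hypCoef q A B C D (n + 1) * β ^ (n + 1) * (1 - q ^ (n + 1)) * newtonPoly q y n))
      atTop (nhds 0) := by
    have := (((hqn.comp (tendsto_add_atTop_nat 1)).const_mul (A * B)).const_sub 1).const_mul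
      (β * y * (y - 1))
    simpa using this.mul s3.tendsto_atTop_zero
  refine hlim.congr fun N => ?_
  induction N with
  | zero =>
    have h := hypCoef_succ (A := A) (B := B) hq hC hD 0
    rw [hypCoef_zero] at h
    simp only [zero_add, Finset.sum_range_one, newtonPoly_zero, hypCoef_zero, pow_zero, pow_one,
      mul_one, one_mul] at h ⊢
    linear_combination y * β * h + (y * (y - 1) * hypCoef q A B C D 1 * β * (1 - q)) * hbal
  | succ N ih =>
    rw [Finset.sum_range_succ, ← ih, newtonPoly_succ_mul_left, newtonPoly_succ]
    have h := hypCoef_succ (A := A) (B := B) hq hC hD (N + 1)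
    linear_combination y * (y - 1) * newtonPoly q y N * β ^ (N + 2) * h +
      hypCoef q A B C D (N + 2) * β ^ (N + 2) * (1 - q ^ (N + 2)) * (y - 1) * newtonPoly q y N *
        q ^ (N + 1) * y * (y - q ^ (N + 1)) * hbal

/-- `(1 - β y) hypSum y` extends continuously to the closed disc `‖β y‖ ≤ 1`, with an explicit
value at `y = 1/β`. -/
lemma exists_boundary_extension (hq : ‖q‖ < 1) (hC : ∀ n : ℕ, 1 - C * q ^ n ≠ 0)
    (hD : ∀ n : ℕ, 1 - D * q ^ n ≠ 0) (hβ : β ≠ 0) :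
    ∃ W : ℂ → ℂ, ContinuousOn W (Metric.closedBall 0 (1 / ‖β‖)) ∧
      (∀ y, ‖β * y‖ < 1 → (1 - β * y) * hypSum q A B C D β y = W y) ∧
      W β⁻¹ = poch q A * poch q B / (poch q q * poch q C * poch q D) * poch q (β * q) := by
  have hb : 0 < ‖β‖ := norm_pos_iff.mpr hβ
  have hρ : 0 < 1 / ‖β‖ := by positivity
  have hlim := tendsto_hypCoef (A := A) (B := B) hq hC hD
  have hlim1 := (tendsto_add_atTop_iff_nat 1).mpr hlim
  have hqn := tendsto_pow_atTop_nhds_zero_of_norm_lt_one hq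
  set r := hypCoef q A B C D with hr
  let k₁ : ℕ → ℂ := fun n => β ^ n * (r (n + 1) - r n)
  let k₂ : ℕ → ℂ := fun n => β ^ (n + 1) * r (n + 1) * q ^ (n + 1)
  have hk₁ : Summable fun n => ‖k₁ n‖ * (1 / ‖β‖) ^ n := by
    have hv := (hlim1.mul (((hqn.const_mul (C * q + D * q + C * D)).const_sub (q + C + D)).add
      ((hqn.pow 2).const_mul (q * C * D)))).sub
        (hlim.mul ((hqn.const_mul (A * B)).const_sub (A + B)))
    obtain ⟨M, -, hM⟩ := exists_norm_le_of_tendsto hv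
    refine summable_norm_mul_of_growth (M := M) (σ := ‖β‖ * ‖q‖) (by positivity) hρ (fun n => ?_)
      (by field_simp; exact hq)
    have h := hypCoef_succ (A := A) (B := B) hq hC hD n
    rw [← hr] at h
    have e : k₁ n = (r (n + 1) * (q + C + D - (C * q + D * q + C * D) * q ^ n +
        q * C * D * (q ^ n) ^ 2) - r n * (A + B - A * B * q ^ n)) * (β * q) ^ n := by
      simp only [k₁, mul_pow]
      linear_combination β ^ n * h
    rw [e, norm_mul, norm_pow, norm_mul β q]
    gcongr
    exact hM n
  have hk₂ : Summable fun n => ‖k₂ n‖ * (1 / ‖β‖) ^ n := by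
    obtain ⟨M, -, hM⟩ := exists_norm_le_of_tendsto (hlim1.mul_const (β * q))
    refine summable_norm_mul_of_growth (M := M) (σ := ‖β‖ * ‖q‖) (by positivity) hρ (fun n => ?_)
      (by field_simp; exact hq)
    have e : k₂ n = r (n + 1) * (β * q) * (β * q) ^ n := by
      simp only [k₂, mul_pow]; ring
    rw [e, norm_mul, norm_pow, norm_mul β q]
    gcongr
    exact hM n
  have hW : ∀ y, ‖y‖ ≤ 1 / ‖β‖ → HasSum
      (fun n => β * y * (k₁ n * newtonPoly q y n) - k₂ n * newtonPoly q y n)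
      (β * y * newtonSum q k₁ y - newtonSum q k₂ y) := fun y hy =>
    ((summable_newton hq hρ hk₁ hy).hasSum.mul_left _).sub (summable_newton hq hρ hk₂ hy).hasSum
  refine ⟨fun y => 1 + (β * y * newtonSum q k₁ y - newtonSum q k₂ y), ?_, fun y hy => ?_, ?_⟩
  · have h1 := continuousOn_newtonSum hq hρ hk₁
    have h2 := continuousOn_newtonSum hq hρ hk₂
    fun_prop
  · obtain ⟨M, hM⟩ := exists_growth_hypSum (A := A) (B := B) hq hC hD β
    have s := summable_newton_of_growth hq hβ hM hy
    have hy' : ‖y‖ ≤ 1 / ‖β‖ := by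
      rw [norm_mul] at hy
      rw [le_div_iff₀ hb]; linarith
    have h := ((s.hasSum.mul_left (1 - β * y)).sub (hW y hy')).tendsto_sum_nat
    have h' : Tendsto (fun N => 1 - r N * β ^ N * newtonPoly q y N) atTop (nhds (1 - 0)) :=
      s.tendsto_atTop_zero.const_sub 1
    have key := tendsto_nhds_unique h (h'.congr fun N => ?_)
    · rw [hypSum, newtonSum]
      linear_combination key
    · induction N with
      | zero => simp [hr, hypCoef_zero, newtonPoly_zero]
      | succ N ih =>
        rw [Finset.sum_range_succ, ← ih, newtonPoly_succ]
        simp only [k₁, k₂]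
        ring
  · have hβ' : β * β⁻¹ = 1 := mul_inv_cancel₀ hβ
    refine tendsto_nhds_unique ((hW β⁻¹ (by simp)).tendsto_sum_nat.const_add 1) ?_
    refine (hlim.mul (tendsto_pochN hq (β * q))).congr fun N => ?_
    induction N with
    | zero => simp [hr, hypCoef_zero, pochN]
    | succ N ih =>
      rw [Finset.sum_range_succ, ← add_assoc, ← ih, pochN_succ, ← newtonPoly_mul_pow q β β⁻¹ hβ' N]
      simp only [k₁, k₂, hβ']
      ring

lemma continuousAt_hypSum (hq : ‖q‖ < 1) (hC : ∀ n : ℕ, 1 - C * q ^ n ≠ 0)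
    (hD : ∀ n : ℕ, 1 - D * q ^ n ≠ 0) (hβ : β ≠ 0) {y : ℂ} (hy : ‖β * y‖ < 1) :
    ContinuousAt (hypSum q A B C D β) y :=
  continuousAt_newtonSum hq hβ (exists_growth_hypSum hq hC hD β).choose_spec hy

lemma continuousAt_hypDeriv (hq : ‖q‖ < 1) (hC : ∀ n : ℕ, 1 - C * q ^ n ≠ 0)
    (hD : ∀ n : ℕ, 1 - D * q ^ n ≠ 0) (hβ : β ≠ 0) {y : ℂ} (hy : ‖β * y‖ < 1) :
    ContinuousAt (hypDeriv q A B C D β) y :=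
  continuousAt_newtonSum hq hβ (exists_growth_hypDeriv hq hC hD β).choose_spec hy

lemma hypSum_self (q A B C D β : ℂ) : hypSum q A B C D β q = 1 := by
  rw [hypSum, newtonSum, tsum_eq_single 0]
  · simp [hypCoef_zero, newtonPoly_zero]
  · intro n hn
    obtain ⟨m, rfl⟩ := Nat.exists_eq_succ_of_ne_zero hn
    rw [Nat.succ_eq_add_one, newtonPoly_self, mul_zero]

end Hyp

/-- The Casorati determinant of the two solutions `hypSum`, divided by `x`. -/
def hypCasorati (q A B a b c d x : ℂ) : ℂ :=
  a * hypDeriv q A B (c * q / a) (d * q / a) (b / a) (a * x) *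
      hypSum q A B (c * q / b) (d * q / b) (a / b) (b * x) -
    b * hypSum q A B (c * q / a) (d * q / a) (b / a) (a * x) *
      hypDeriv q A B (c * q / b) (d * q / b) (a / b) (b * x)

section Casorati

variable {q A B a b c d : ℂ}

lemma norm_mul_lt_one_of_lt_one {y : ℂ} (hq : ‖q‖ < 1) (h : ‖y‖ < 1) : ‖q * y‖ < 1 := by
  rw [norm_mul]
  nlinarith [norm_nonneg q, norm_nonneg y]

lemma casorati_eq_mul (hq : ‖q‖ < 1) (ha : a ≠ 0) (hb : b ≠ 0)
    (hca : ∀ n : ℕ, 1 - c * q / a * q ^ n ≠ 0) (hda : ∀ n : ℕ, 1 - d * q / a * q ^ n ≠ 0)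
    (hcb : ∀ n : ℕ, 1 - c * q / b * q ^ n ≠ 0) (hdb : ∀ n : ℕ, 1 - d * q / b * q ^ n ≠ 0)
    {x : ℂ} (hax : ‖a * x‖ < 1) (hbx : ‖b * x‖ < 1) :
    hypSum q A B (c * q / a) (d * q / a) (b / a) (a * x) *
        hypSum q A B (c * q / b) (d * q / b) (a / b) (b * (q * x)) -
      hypSum q A B (c * q / a) (d * q / a) (b / a) (a * (q * x)) *
        hypSum q A B (c * q / b) (d * q / b) (a / b) (b * x) =
      x * hypCasorati q A B a b c d x := by
  have e1 : b / a * (a * x) = b * x := by field_simp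
  have e2 : b / a * (q * (a * x)) = q * (b * x) := by field_simp
  have e3 : a / b * (b * x) = a * x := by field_simp
  have e4 : a / b * (q * (b * x)) = q * (a * x) := by field_simp
  have h1 := hypSum_sub (A := A) (B := B) hq hca hda (div_ne_zero hb ha)
    (by rwa [e1] : ‖b / a * (a * x)‖ < 1) (by rw [e2]; exact norm_mul_lt_one_of_lt_one hq hbx)
  have h2 := hypSum_sub (A := A) (B := B) hq hcb hdb (div_ne_zero ha hb)
    (by rwa [e3] : ‖a / b * (b * x)‖ < 1) (by rw [e4]; exact norm_mul_lt_one_of_lt_one hq hax)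
  rw [mul_left_comm a q x, mul_left_comm b q x, hypCasorati]
  linear_combination hypSum q A B (c * q / b) (d * q / b) (a / b) (b * x) * h1 -
    hypSum q A B (c * q / a) (d * q / a) (b / a) (a * x) * h2

lemma hypCasorati_mul_left (hq : ‖q‖ < 1) (ha : a ≠ 0) (hb : b ≠ 0)
    (hbal : A * B * (a * b) = c * d * q)
    (hca : ∀ n : ℕ, 1 - c * q / a * q ^ n ≠ 0) (hda : ∀ n : ℕ, 1 - d * q / a * q ^ n ≠ 0)
    (hcb : ∀ n : ℕ, 1 - c * q / b * q ^ n ≠ 0) (hdb : ∀ n : ℕ, 1 - d * q / b * q ^ n ≠ 0)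
    {x : ℂ} (hax : ‖a * x‖ < 1) (hbx : ‖b * x‖ < 1) :
    (1 - a * x) * (1 - b * x) * hypCasorati q A B a b c d x =
      (1 - c * q * x) * (1 - d * q * x) * hypCasorati q A B a b c d (q * x) := by
  have e1 : b / a * (a * x) = b * x := by field_simp
  have e2 : b / a * (q * (a * x)) = q * (b * x) := by field_simp
  have e3 : a / b * (b * x) = a * x := by field_simp
  have e4 : a / b * (q * (b * x)) = q * (a * x) := by field_simp
  have e5 : c * q / a * (a * x) = c * q * x := by field_simp
  have e6 : d * q / a * (a * x) = d * q * x := by field_simp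
  have e7 : c * q / b * (b * x) = c * q * x := by field_simp
  have e8 : d * q / b * (b * x) = d * q * x := by field_simp
  have n1 : ‖b / a * (a * x)‖ < 1 := by rwa [e1]
  have n2 : ‖b / a * (q * (a * x))‖ < 1 := by rw [e2]; exact norm_mul_lt_one_of_lt_one hq hbx
  have n3 : ‖a / b * (b * x)‖ < 1 := by rwa [e3]
  have n4 : ‖a / b * (q * (b * x))‖ < 1 := by rw [e4]; exact norm_mul_lt_one_of_lt_one hq hax
  have b1 : c * q / a * (d * q / a) = A * B * q * (b / a) := by
    field_simp; linear_combination -q * hbal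
  have b2 : c * q / b * (d * q / b) = A * B * q * (a / b) := by
    field_simp; linear_combination -q * hbal
  have h1 := hypSum_sub (A := A) (B := B) hq hca hda (div_ne_zero hb ha) n1 n2
  have h2 := hypSum_sub (A := A) (B := B) hq hcb hdb (div_ne_zero ha hb) n3 n4
  have h3 := hyp_difference_eq (A := A) (B := B) hq hca hda (div_ne_zero hb ha) b1 n1 n2
  have h4 := hyp_difference_eq (A := A) (B := B) hq hcb hdb (div_ne_zero ha hb) b2 n3 n4
  rw [e1, e5, e6] at h3
  rw [e3, e7, e8] at h4
  simp only [hypCasorati, mul_left_comm a q x, mul_left_comm b q x]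
  set f := hypSum q A B (c * q / a) (d * q / a) (b / a)
  set g := hypSum q A B (c * q / b) (d * q / b) (a / b)
  set F := hypDeriv q A B (c * q / a) (d * q / a) (b / a)
  set G := hypDeriv q A B (c * q / b) (d * q / b) (a / b)
  have h5 : a * F (a * x) * g (b * x) - b * f (a * x) * G (b * x) =
      a * F (a * x) * g (q * (b * x)) - b * f (q * (a * x)) * G (b * x) := by
    linear_combination a * F (a * x) * h2 - b * G (b * x) * h1
  rw [h5]
  linear_combination a * g (q * (b * x)) * h3 - b * f (q * (a * x)) * h4

lemma hypCasorati_mul_pochN (hq : ‖q‖ < 1) (ha : a ≠ 0) (hb : b ≠ 0)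
    (hbal : A * B * (a * b) = c * d * q)
    (hca : ∀ n : ℕ, 1 - c * q / a * q ^ n ≠ 0) (hda : ∀ n : ℕ, 1 - d * q / a * q ^ n ≠ 0)
    (hcb : ∀ n : ℕ, 1 - c * q / b * q ^ n ≠ 0) (hdb : ∀ n : ℕ, 1 - d * q / b * q ^ n ≠ 0)
    {x : ℂ} (hax : ‖a * x‖ < 1) (hbx : ‖b * x‖ < 1) (n : ℕ) :
    hypCasorati q A B a b c d x * (pochN q (a * x) n * pochN q (b * x) n) =
      pochN q (c * q * x) n * pochN q (d * q * x) n *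
        hypCasorati q A B a b c d (q ^ n * x) := by
  induction n with
  | zero => simp [pochN]
  | succ n ih =>
    have hqn : ‖q ^ n‖ ≤ 1 := by rw [norm_pow]; exact pow_le_one₀ (norm_nonneg q) hq.le
    have hn : ∀ y : ℂ, ‖y * x‖ < 1 → ‖y * (q ^ n * x)‖ < 1 := fun y hy => by
      rw [mul_left_comm, norm_mul]
      exact (mul_le_of_le_one_left (norm_nonneg _) hqn).trans_lt hy
    have h := hypCasorati_mul_left hq ha hb hbal hca hda hcb hdb (hn a hax) (hn b hbx)
    rw [← mul_assoc q, ← pow_succ'] at h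
    simp only [pochN_succ]
    linear_combination (1 - a * x * q ^ n) * (1 - b * x * q ^ n) * ih +
      pochN q (c * q * x) n * pochN q (d * q * x) n * h

lemma hypCasorati_mul_poch (hq : ‖q‖ < 1) (ha : a ≠ 0) (hb : b ≠ 0)
    (hbal : A * B * (a * b) = c * d * q)
    (hca : ∀ n : ℕ, 1 - c * q / a * q ^ n ≠ 0) (hda : ∀ n : ℕ, 1 - d * q / a * q ^ n ≠ 0)
    (hcb : ∀ n : ℕ, 1 - c * q / b * q ^ n ≠ 0) (hdb : ∀ n : ℕ, 1 - d * q / b * q ^ n ≠ 0)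
    {x : ℂ} (hax : ‖a * x‖ < 1) (hbx : ‖b * x‖ < 1) :
    hypCasorati q A B a b c d x * (poch q (a * x) * poch q (b * x)) =
      poch q (c * q * x) * poch q (d * q * x) * hypCasorati q A B a b c d 0 := by
  have hc : ContinuousAt (hypCasorati q A B a b c d) 0 := by
    have z1 : ‖b / a * (a * 0)‖ < 1 := by simp
    have z2 : ‖a / b * (b * 0)‖ < 1 := by simp
    have ma : ContinuousAt (fun x : ℂ => a * x) 0 := by fun_prop
    have mb : ContinuousAt (fun x : ℂ => b * x) 0 := by fun_prop
    have c1 := (continuousAt_hypSum (A := A) (B := B) hq hca hda (div_ne_zero hb ha) z1).comp' ma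
    have c2 := (continuousAt_hypDeriv (A := A) (B := B) hq hca hda (div_ne_zero hb ha) z1).comp' ma
    have c3 := (continuousAt_hypSum (A := A) (B := B) hq hcb hdb (div_ne_zero ha hb) z2).comp' mb
    have c4 := (continuousAt_hypDeriv (A := A) (B := B) hq hcb hdb (div_ne_zero ha hb) z2).comp' mb
    exact ((c2.const_mul a).mul c3).sub ((c1.const_mul b).mul c4)
  have hx0 : Tendsto (fun n : ℕ => q ^ n * x) atTop (nhds 0) := by
    simpa using (tendsto_pow_atTop_nhds_zero_of_norm_lt_one hq).mul_const x
  refine tendsto_nhds_unique (((tendsto_pochN hq (a * x)).mul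
    (tendsto_pochN hq (b * x))).const_mul (hypCasorati q A B a b c d x)) ?_
  refine (((tendsto_pochN hq (c * q * x)).mul (tendsto_pochN hq (d * q * x))).mul
    (hc.tendsto.comp hx0)).congr fun n => ?_
  exact (hypCasorati_mul_pochN hq ha hb hbal hca hda hcb hdb hax hbx n).symm

/-- The value of the Casorati determinant at `0`, from its behaviour as `x → 1/b`. -/
lemma hypCasorati_zero (hq : ‖q‖ < 1) (ha : a ≠ 0) (hb : b ≠ 0)
    (hab : a ≠ b) (hle : ‖a‖ ≤ ‖b‖) (hbal : A * B * (a * b) = c * d * q)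
    (hca : ∀ n : ℕ, 1 - c * q / a * q ^ n ≠ 0) (hda : ∀ n : ℕ, 1 - d * q / a * q ^ n ≠ 0)
    (hcb : ∀ n : ℕ, 1 - c * q / b * q ^ n ≠ 0) (hdb : ∀ n : ℕ, 1 - d * q / b * q ^ n ≠ 0) :
    hypCasorati q A B a b c d 0 =
      b * (poch q A * poch q B * (poch q (a / b) * poch q (b / a * q))) /
        (poch q (c * q / a) * poch q (c * q / b) * poch q (d * q / a) * poch q (d * q / b)) := by
  obtain ⟨W, hW, hWeq, hWv⟩ :=
    exists_boundary_extension (A := A) (B := B) hq hca hda (div_ne_zero hb ha)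
  obtain ⟨V, hV, hVeq, -⟩ :=
    exists_boundary_extension (A := A) (B := B) hq hcb hdb (div_ne_zero ha hb)
  have hbn : 0 < ‖b‖ := norm_pos_iff.mpr hb
  have han : 0 < ‖a‖ := norm_pos_iff.mpr ha
  rw [inv_div] at hWv
  have hle1 : ‖a / b‖ ≤ 1 := by rw [norm_div]; exact (div_le_one hbn).mpr hle
  let X : ℝ → ℂ := fun t => (t : ℂ) / b
  have hX : Tendsto X (nhdsWithin 1 (Set.Iio 1)) (nhds (1 / b)) := by
    have : Continuous X := by fun_prop
    simpa [X] using (this.tendsto 1).mono_left nhdsWithin_le_nhds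
  have hev : ∀ᶠ t : ℝ in nhdsWithin 1 (Set.Iio 1), 0 < t ∧ t < 1 := by
    filter_upwards [self_mem_nhdsWithin, nhdsWithin_le_nhds (lt_mem_nhds zero_lt_one)]
      with t h1 h2 using ⟨h2, h1⟩
  have hbX : ∀ t : ℝ, 0 < t → t < 1 → ‖b * X t‖ < 1 := fun t h0 h1 => by
    have : b * X t = (t : ℂ) := by simp only [X]; field_simp
    rw [this, Complex.norm_real, Real.norm_of_nonneg h0.le]; exact h1
  have haX : ∀ t : ℝ, 0 < t → t < 1 → ‖a * X t‖ < 1 := fun t h0 h1 => by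
    have : a * X t = a / b * (b * X t) := by field_simp
    rw [this, norm_mul]
    exact (mul_le_of_le_one_left (norm_nonneg _) hle1).trans_lt (hbX t h0 h1)
  have tW : Tendsto (fun t => W (a * X t)) (nhdsWithin 1 (Set.Iio 1)) (nhds (W (a / b))) := by
    refine (hW (a / b) (by simp)).tendsto.comp (tendsto_nhdsWithin_iff.mpr ⟨?_, ?_⟩)
    · simpa only [mul_one_div] using hX.const_mul a
    · filter_upwards [hev] with t ht
      have h := hbX t ht.1 ht.2
      have : a * X t = a / b * (b * X t) := by field_simp
      rw [mem_closedBall_zero_iff, this, norm_mul, norm_div, norm_div, one_div_div]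
      exact mul_le_of_le_one_right (by positivity) h.le
  have tV : Tendsto (fun t => V (b * X t)) (nhdsWithin 1 (Set.Iio 1)) (nhds (V 1)) := by
    have h1 : 1 ≤ 1 / ‖a / b‖ := by
      rw [one_le_div (norm_pos_iff.mpr (div_ne_zero ha hb))]; exact hle1
    refine (hV 1 (by simpa using h1)).tendsto.comp (tendsto_nhdsWithin_iff.mpr ⟨?_, ?_⟩)
    · simpa [mul_inv_cancel₀ hb] using hX.const_mul b
    · filter_upwards [hev] with t ht
      rw [mem_closedBall_zero_iff]
      exact (hbX t ht.1 ht.2).le.trans h1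
  have tP : ∀ y : ℂ, Tendsto (fun t => poch q (y * X t)) (nhdsWithin 1 (Set.Iio 1))
      (nhds (poch q (y / b))) := fun y => by
    have := ((continuous_poch hq).tendsto (y * (1 / b))).comp (hX.const_mul y)
    simpa only [mul_one_div] using! this
  have tg : Tendsto (fun t => hypSum q A B (c * q / b) (d * q / b) (a / b) (b * (q * X t)))
      (nhdsWithin 1 (Set.Iio 1)) (nhds 1) := by
    have h : ‖a / b * q‖ < 1 := by
      rw [norm_mul]
      exact (mul_le_of_le_one_left (norm_nonneg _) hle1).trans_lt hq
    have := (continuousAt_hypSum (A := A) (B := B) hq hcb hdb (div_ne_zero ha hb) h).tendsto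
    rw [hypSum_self] at this
    refine this.comp ?_
    convert (hX.const_mul q).const_mul b using 2
    field_simp
  have tf : Tendsto (fun t => hypSum q A B (c * q / a) (d * q / a) (b / a) (a * (q * X t)))
      (nhdsWithin 1 (Set.Iio 1))
      (nhds (hypSum q A B (c * q / a) (d * q / a) (b / a) (a * (q * (1 / b))))) := by
    have h : ‖b / a * (a * (q * (1 / b)))‖ < 1 := by
      have : b / a * (a * (q * (1 / b))) = q := by field_simp
      rwa [this]
    exact (continuousAt_hypSum (A := A) (B := B) hq hca hda
      (div_ne_zero hb ha) h).tendsto.comp ((hX.const_mul q).const_mul a)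
  have t1a : Tendsto (fun t => 1 - a * X t) (nhdsWithin 1 (Set.Iio 1)) (nhds (1 - a / b)) := by
    simpa only [mul_one_div] using (hX.const_mul a).const_sub 1
  have t1b : Tendsto (fun t => 1 - b * X t) (nhdsWithin 1 (Set.Iio 1)) (nhds 0) := by
    simpa [mul_inv_cancel₀ hb] using (hX.const_mul b).const_sub 1
  have L := (((t1a.mul tW).mul tg).sub ((tf.mul t1b).mul tV)).mul ((tP a).mul (tP (b * q)))
  have R := ((t1a.mul hX).mul ((tP (c * q)).mul (tP (d * q)))).mul_const
    (hypCasorati q A B a b c d 0)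
  have key := tendsto_nhds_unique (L.congr' ?_) R
  · have h1 : (1 : ℂ) - a / b ≠ 0 := by
      rw [sub_ne_zero, Ne, eq_comm, div_eq_one_iff_eq hb]; exact hab
    have p1 := poch_ne_zero hq hca
    have p2 := poch_ne_zero hq hda
    have p3 := poch_ne_zero hq hcb
    have p4 := poch_ne_zero hq hdb
    have p5 := poch_ne_zero hq (one_sub_self_mul_pow_ne_zero hq)
    have e : b * q / b = q := by field_simp
    rw [hWv, e, mul_zero, zero_mul, sub_zero, mul_one, mul_assoc, mul_assoc, mul_assoc,
      mul_assoc] at key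
    have key' := mul_left_cancel₀ h1 (key.trans (mul_assoc _ _ _))
    rw [eq_div_iff (mul_ne_zero (mul_ne_zero (mul_ne_zero p1 p3) p2) p4)]
    generalize poch q (c * q / a) = P₁, poch q (d * q / a) = P₂, poch q (c * q / b) = P₃,
      poch q (d * q / b) = P₄, poch q q = P₅, poch q (a / b) = P₆, poch q (b / a * q) = P₇
      at key' p1 p2 p3 p4 p5 ⊢
    field_simp at key'
    linear_combination -key'
  · filter_upwards [hev] with t ht
    have hax := haX t ht.1 ht.2
    have hbx := hbX t ht.1 ht.2
    have e1 : b / a * (a * X t) = b * X t := by field_simp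
    have e2 : a / b * (b * X t) = a * X t := by field_simp
    have w := hWeq (a * X t) (by rwa [e1])
    have v := hVeq (b * X t) (by rwa [e2])
    rw [e1] at w
    rw [e2] at v
    have h1 := casorati_eq_mul (A := A) (B := B) hq ha hb hca hda hcb hdb hax hbx
    have h2 := hypCasorati_mul_poch hq ha hb hbal hca hda hcb hdb hax hbx
    rw [poch_eq_mul hq (b * X t), mul_right_comm b (X t) q] at h2
    rw [← w, ← v]
    linear_combination (1 - a * X t) * (1 - b * X t) * poch q (a * X t) *
      poch q (b * q * X t) * h1 + (1 - a * X t) * X t * h2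

end Casorati

lemma newtonPoly_eq_pochN (q : ℂ) {y : ℂ} (hy : y ≠ 0) (n : ℕ) :
    newtonPoly q y n = pochN q (q / y) n * y ^ n := by
  induction n with
  | zero => simp [newtonPoly, pochN]
  | succ n ih =>
    rw [newtonPoly_succ, pochN_succ, ih]
    field_simp
    ring

lemma sP_comm (q : ℝ) (a b c d : ℂ) : sP q b a c d = sP q a b c d := by
  rw [sP, sP, mul_comm b a]

lemma sP_sq (q : ℝ) (a b c d : ℂ) : sP q a b c d ^ 2 = c * d * q / (a * b) := by
  rw [sP, ← Complex.cpow_nat_mul]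
  norm_num

lemma phi_eq_hypSum (q : ℝ) {a : ℂ} (b c d γ : ℂ) {x : ℂ} (ha : a ≠ 0) (hx : x ≠ 0) :
    phi q a b c d γ x =
      hypSum q (sP q a b c d * γ) (sP q a b c d / γ) (c * q / a) (d * q / a) (b / a) (a * x) := by
  refine tsum_congr fun n => ?_
  have h : b * x = b / a * (a * x) := by field_simp
  rw [h, mul_pow]
  simp only [hypCoef, newtonPoly_eq_pochN _ (mul_ne_zero ha hx)]
  ring

lemma norm_le_of_pairCond {q zm zp : ℝ} {a b : ℂ} (hq0 : 0 < q) (hzm : zm < 0) (hzp : 0 < zp)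
    (h : pairCond q zm zp a b) : ‖a‖ ≤ ‖b‖ := by
  rcases h with h | ⟨A, B, k, rfl, rfl, h1, h2, -⟩ | ⟨A, B, k, rfl, rfl, -, h2, h3⟩
  · rw [h, RCLike.norm_conj]
  · have hB : 0 < 1 / B := lt_trans (by positivity) h1
    have hA : 0 < 1 / A := hB.trans h2
    rw [one_div_pos] at hA hB
    rw [Complex.norm_real, Complex.norm_real, Real.norm_of_nonneg hA.le, Real.norm_of_nonneg hB.le]
    exact ((one_div_lt_one_div hB hA).mp h2).le
  · have hB : 1 / B < 0 := h3.trans (mul_neg_of_neg_of_pos hzm (zpow_pos hq0 k))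
    have hA : 1 / A < 0 := h2.trans hB
    rw [one_div_neg] at hA hB
    rw [Complex.norm_real, Complex.norm_real, Real.norm_of_nonpos hA.le, Real.norm_of_nonpos hB.le]
    exact neg_le_neg ((one_div_lt_one_div_of_neg hA hB).mp h2).le

lemma one_sub_div_mul_pow_ne_zero {q a c : ℂ} (h : ∀ k : ℤ, c / a ≠ q ^ k) (n : ℕ) :
    1 - c * q / a * q ^ n ≠ 0 := by
  intro h0
  apply h (-((n : ℤ) + 1))
  rw [zpow_neg, ← Nat.cast_succ, zpow_natCast]
  refine eq_inv_of_mul_eq_one_left ?_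
  rw [pow_succ]
  linear_combination -h0

lemma one_sub_mul_pow_ne_zero_of_mem_Rq {q zm zp x : ℝ} {c : ℂ} (hq0 : 0 < q) (hzm : zm < 0)
    (hzp : 0 < zp) (hx : x ∈ Rq q zm zp)
    (h : ∀ k : ℤ, c ≠ ((zp : ℂ))⁻¹ * (q : ℂ) ^ k ∧ c ≠ ((zm : ℂ))⁻¹ * (q : ℂ) ^ k) (n : ℕ) :
    1 - c * x * (q : ℂ) ^ n ≠ 0 := by
  have hq : (q : ℂ) ≠ 0 := by exact_mod_cast hq0.ne'
  have hzp' : (zp : ℂ) ≠ 0 := by exact_mod_cast hzp.ne'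
  have hzm' : (zm : ℂ) ≠ 0 := by exact_mod_cast hzm.ne
  have key : ∀ (z : ℂ) (k : ℤ), z ≠ 0 → 1 - c * (z * (q : ℂ) ^ k) * (q : ℂ) ^ n = 0 →
      c = z⁻¹ * (q : ℂ) ^ (-(k + n)) := fun z k hz h0 => by
    have hk := zpow_ne_zero k hq
    rw [zpow_neg, zpow_add₀ hq, zpow_natCast, ← mul_inv]
    refine eq_inv_of_mul_eq_one_left ?_
    linear_combination -h0
  intro h0
  obtain ⟨k, rfl | rfl⟩ := hx
  · exact (h _).2 (key zm k hzm' (by push_cast at h0; exact h0))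
  · exact (h _).1 (key zp k hzp' (by push_cast at h0; exact h0))

/-- the Casorati determinant of `φ_γ` and `φ_γ† `. -/
theorem statement8 (q zm zp : ℝ) (a b c d : ℂ)
    (hq0 : 0 < q) (hq1 : q < 1) (hzm : zm < 0) (hzp : 0 < zp)
    (hPg : memPgen q zm zp a b c d) (γ : ℂ) (hγ : γ ≠ 0)
    (x : ℝ) (hx : x ∈ Rq q zm zp) (hxb : |x| < 1 / ‖b‖) :
    casD q a b c d (fun t : ℝ => phi q a b c d γ (t : ℂ))
        (fun t : ℝ => phi q b a c d γ (t : ℂ)) x =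
      (1 - (q : ℂ)) * q / (a * sP q a b c d) *
        (poch q (sP q a b c d * γ) * poch q (sP q a b c d / γ) * theta q (a / b)) /
        (poch q (c * q / a) * poch q (c * q / b) * poch q (d * q / a) *
          poch q (d * q / b)) := by
  obtain ⟨⟨ha, hb, hc, hd, hab, hP, hpab, -⟩, -, hgen⟩ := hPg
  have hqc : (q : ℂ) ≠ 0 := by exact_mod_cast hq0.ne'
  have hqn : ‖(q : ℂ)‖ < 1 := by rwa [Complex.norm_real, Real.norm_of_nonneg hq0.le]
  have hle := norm_le_of_pairCond hq0 hzm hzp hpab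
  have hca := one_sub_div_mul_pow_ne_zero fun k => (hgen k).1
  have hcb := one_sub_div_mul_pow_ne_zero fun k => (hgen k).2.1
  have hda := one_sub_div_mul_pow_ne_zero fun k => (hgen k).2.2.1
  have hdb := one_sub_div_mul_pow_ne_zero fun k => (hgen k).2.2.2.1
  have hcx := one_sub_mul_pow_ne_zero_of_mem_Rq hq0 hzm hzp hx (hP c (by simp))
  have hdx := one_sub_mul_pow_ne_zero_of_mem_Rq hq0 hzm hzp hx (hP d (by simp))
  have hx0 : (x : ℂ) ≠ 0 := by
    have : x ≠ 0 := by
      obtain ⟨k, rfl | rfl⟩ := hx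
      · exact mul_ne_zero hzm.ne (zpow_pos hq0 k).ne'
      · exact mul_ne_zero hzp.ne' (zpow_pos hq0 k).ne'
    exact_mod_cast this
  have hbx : ‖b * x‖ < 1 := by
    rw [norm_mul, Complex.norm_real, Real.norm_eq_abs]
    rw [lt_div_iff₀ (norm_pos_iff.mpr hb)] at hxb
    linarith
  have hax : ‖a * x‖ < 1 := by
    rw [norm_mul] at hbx ⊢
    exact (mul_le_mul_of_nonneg_right hle (norm_nonneg _)).trans_lt hbx
  have hs2 := sP_sq q a b c d
  simp only [casD, u, w, Bcoef, theta, Complex.ofReal_mul]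
  rw [phi_eq_hypSum q b c d γ ha hx0, phi_eq_hypSum q b c d γ ha (mul_ne_zero hqc hx0),
    phi_eq_hypSum q a c d γ hb hx0, phi_eq_hypSum q a c d γ hb (mul_ne_zero hqc hx0),
    sP_comm q a b c d]
  set s := sP q a b c d
  have hs : s ≠ 0 := by
    intro h0
    rw [h0, zero_pow two_ne_zero, eq_comm] at hs2
    simp [ha, hb, hc, hd, hqc] at hs2
  have hbal : s * γ * (s / γ) * (a * b) = c * d * q := by
    field_simp at hs2 ⊢
    linear_combination hs2
  rw [casorati_eq_mul hqn ha hb hca hda hcb hdb hax hbx]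
  have h1 := hypCasorati_mul_poch hqn ha hb hbal hca hda hcb hdb hax hbx
  rw [hypCasorati_zero hqn ha hb hab hle hbal hca hda hcb hdb] at h1
  set E := hypCasorati q (s * γ) (s / γ) a b c d x
  have hcx0 := hcx 0
  have hdx0 := hdx 0
  have pc := poch_ne_zero hqn hcx
  have pd := poch_ne_zero hqn hdx
  rw [poch_eq_mul hqn] at pc pd
  rw [poch_eq_mul hqn (c * x), poch_eq_mul hqn (d * x)]
  rw [mul_right_comm c] at pc
  rw [mul_right_comm d] at pd
  rw [mul_right_comm c, mul_right_comm d]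
  rw [pow_zero, mul_one] at hcx0 hdx0
  have h1q : (1 : ℂ) - q ≠ 0 := by
    have := one_sub_self_mul_pow_ne_zero hqn 0
    rwa [pow_zero, mul_one] at this
  have hba : (q : ℂ) / (a / b) = b / a * q := by field_simp
  rw [hba]
  have pc' := (mul_ne_zero_iff.mp pc).2
  have pd' := (mul_ne_zero_iff.mp pd).2
  have p1 := poch_ne_zero hqn hca
  have p2 := poch_ne_zero hqn hda
  have p3 := poch_ne_zero hqn hcb
  have p4 := poch_ne_zero hqn hdb
  generalize poch (q : ℂ) (c * q / a) = P₁, poch (q : ℂ) (d * q / a) = P₂,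
    poch (q : ℂ) (c * q / b) = P₃, poch (q : ℂ) (d * q / b) = P₄,
    poch (q : ℂ) (a / b) = P₅, poch (q : ℂ) (b / a * q) = P₆,
    poch (q : ℂ) (c * q * x) = P₇, poch (q : ℂ) (d * q * x) = P₈,
    poch (q : ℂ) (a * x) = Pa, poch (q : ℂ) (b * x) = Pb,
    poch (q : ℂ) (s * γ) = PA, poch (q : ℂ) (s / γ) = PB
    at h1 p1 p2 p3 p4 pc' pd' ⊢
  have hcx1 : 1 - 1 / (c * x) = -(1 - c * x) / (c * x) := by field_simp; ring
  have hdx1 : 1 - 1 / (d * x) = -(1 - d * x) / (d * x) := by field_simp; ring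
  calc _ = (1 - (q : ℂ)) * s / (c * d) * (E * (Pa * Pb)) / (P₇ * P₈) := by
        rw [hcx1, hdx1]
        generalize 1 - c * (x : ℂ) = C, 1 - d * (x : ℂ) = D at hcx0 hdx0
        field_simp
    _ = _ := by
      rw [h1]
      field_simp at hs2 ⊢
      linear_combination PA * PB * P₅ * P₆ * hs2
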